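/- arXiv:2205.05959 — 7 statements merged into one kernel-verified Lean document; each statement's English description precedes it below -/
import Mathlib

section
/- Let X₁, X₂, X₃ ∈ M_k(ℂ) be Hermitian matrices. Then tr(X₂X₁²X₂X₃²), tr(X₁⁴X₂² + X₁²X₂⁴), and tr(X₃⁶) are nonnegative real numbers, and 4·(tr(X₂X₁²X₂X₃²))³ ≤ (tr(X₁⁴X₂² + X₁²X₂⁴))² · tr(X₃⁶). -/
open scoped ComplexOrder


open Matrix in
theorem mh_spec {k : ℕ} (A : Matrix (Fin k) (Fin k) ℂ) (hA : A.PosSemidef) :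
    ∃ (V : Matrix (Fin k) (Fin k) ℂ) (p : Fin k → ℝ), (∀ i, 0 ≤ p i) ∧ Vᴴ * V = 1 ∧ V * Vᴴ = 1 ∧
      A = V * diagonal (fun i => (p i : ℂ)) * Vᴴ := by
  refine ⟨hA.1.eigenvectorUnitary, hA.1.eigenvalues, hA.eigenvalues_nonneg, ?_, ?_, ?_⟩
  · exact Unitary.coe_star_mul_self hA.1.eigenvectorUnitary
  · exact Unitary.coe_mul_star_self hA.1.eigenvectorUnitary
  · exact hA.1.spectral_theorem

open Matrix in
theorem mh_pow {k : ℕ} (V : Matrix (Fin k) (Fin k) ℂ) (p : Fin k → ℝ)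
    (h1 : Vᴴ * V = 1) (h2 : V * Vᴴ = 1) (m : ℕ) :
    (V * diagonal (fun i => (p i : ℂ)) * Vᴴ) ^ m
      = V * diagonal (fun i => ((p i ^ m : ℝ) : ℂ)) * Vᴴ := by
  induction m with
  | zero => simp [h2]
  | succ m ih =>
    rw [pow_succ, ih]
    calc _ = V * diagonal (fun i => ((p i ^ m : ℝ) : ℂ)) * (Vᴴ * V)
          * diagonal (fun i => (p i : ℂ)) * Vᴴ := by simp only [Matrix.mul_assoc]
      _ = _ := by
        rw [h1, Matrix.mul_one, Matrix.mul_assoc V, diagonal_mul_diagonal]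
        simp [pow_succ]

open Matrix in
theorem mh_sqrt {k : ℕ} (A : Matrix (Fin k) (Fin k) ℂ) (hA : A.PosSemidef) :
    ∃ R : Matrix (Fin k) (Fin k) ℂ, R.PosSemidef ∧ R * R = A := by
  obtain ⟨V, p, hp, h1, h2, rfl⟩ := mh_spec A hA
  refine ⟨V * diagonal (fun i => ((Real.sqrt (p i) : ℝ) : ℂ)) * Vᴴ, ?_, ?_⟩
  · apply PosSemidef.mul_mul_conjTranspose_same
    rw [posSemidef_diagonal_iff]
    intro i
    exact_mod_cast Real.sqrt_nonneg _
  · rw [← pow_two, mh_pow V _ h1 h2]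
    simp only [Real.sq_sqrt (hp _)]

open Matrix in
theorem mh_trace {k : ℕ} (R D : Matrix (Fin k) (Fin k) ℂ) (hR : R.PosSemidef)
    (hD : D.PosSemidef) :
    ∃ (w : Fin k → Fin k → ℝ) (p d : Fin k → ℝ), (∀ i j, 0 ≤ w i j) ∧ (∀ i, 0 ≤ p i) ∧
      (∀ i, 0 ≤ d i) ∧ ∀ m n : ℕ, trace (R ^ m * D ^ n)
        = ((∑ i, ∑ j, w i j * (p i ^ m * d j ^ n) : ℝ) : ℂ) := by
  obtain ⟨V, p, hp, h1, h2, rfl⟩ := mh_spec R hR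
  obtain ⟨W, d, hd, h3, h4, rfl⟩ := mh_spec D hD
  refine ⟨fun i j => Complex.normSq ((Vᴴ * W) i j), p, d, fun _ _ => Complex.normSq_nonneg _,
    hp, hd, fun m n => ?_⟩
  rw [mh_pow V p h1 h2, mh_pow W d h3 h4]
  have : trace (V * diagonal (fun i => ((p i ^ m : ℝ) : ℂ)) * Vᴴ *
      (W * diagonal (fun i => ((d i ^ n : ℝ) : ℂ)) * Wᴴ))
      = trace (diagonal (fun i => ((p i ^ m : ℝ) : ℂ)) *
        ((Vᴴ * W) * (diagonal (fun i => ((d i ^ n : ℝ) : ℂ)) * (Vᴴ * W)ᴴ))) := by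
    rw [Matrix.mul_assoc V, Matrix.mul_assoc V, trace_mul_comm V]
    simp only [Matrix.mul_assoc, conjTranspose_mul, conjTranspose_conjTranspose]
  rw [this]
  generalize Vᴴ * W = M
  simp only [trace, diag, diagonal_mul]
  push_cast
  refine Finset.sum_congr rfl fun i _ => ?_
  rw [Matrix.mul_apply, Finset.mul_sum]
  refine Finset.sum_congr rfl fun j _ => ?_
  rw [diagonal_mul, conjTranspose_apply, Complex.normSq_eq_conj_mul_self]
  simp only [Complex.star_def]
  ring

theorem mh_real (S X Y : ℝ) (hS : 0 ≤ S) (hX : 0 ≤ X)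
    (h : ∀ a : ℝ, 0 ≤ a → 3 * a ^ 2 * S ≤ 2 * a ^ 3 * X + Y) : S ^ 3 ≤ X ^ 2 * Y := by
  rcases hX.eq_or_lt with rfl | hX
  · rcases hS.eq_or_lt with rfl | hS
    · simp
    · exfalso
      have hY : 0 ≤ Y := by simpa using h 0 le_rfl
      have := h ((Y + 1) / S + 1) (by positivity)
      have h2 : (Y + 1) / S * S = Y + 1 := by field_simp
      have h3 : 0 ≤ (Y + 1) / S := by positivity
      nlinarith [mul_nonneg (mul_nonneg h3 h3) hS.le]
  · have := h (S / X) (by positivity)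
    have h2 := mul_le_mul_of_nonneg_left this (sq_nonneg X)
    have e1 : X ^ 2 * (3 * (S / X) ^ 2 * S) = 3 * S ^ 3 := by field_simp
    have e2 : X ^ 2 * (2 * (S / X) ^ 3 * X + Y) = 2 * S ^ 3 + X ^ 2 * Y := by field_simp
    linarith

open Matrix in
theorem mh_holder {k : ℕ} (R D : Matrix (Fin k) (Fin k) ℂ) (hR : R.PosSemidef)
    (hD : D.PosSemidef) :
    ∃ S X Y : ℝ, 0 ≤ S ∧ 0 ≤ X ∧ 0 ≤ Y ∧ trace (R ^ 2 * D) = (S : ℂ) ∧ trace (R ^ 3) = (X : ℂ) ∧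
      trace (D ^ 3) = (Y : ℂ) ∧ S ^ 3 ≤ X ^ 2 * Y := by
  obtain ⟨w, p, d, hw, hp, hd, h⟩ := mh_trace R D hR hD
  have nn : ∀ m n : ℕ, 0 ≤ ∑ i, ∑ j, w i j * (p i ^ m * d j ^ n) := fun m n =>
    Finset.sum_nonneg fun i _ => Finset.sum_nonneg fun j _ =>
      mul_nonneg (hw i j) (mul_nonneg (pow_nonneg (hp i) _) (pow_nonneg (hd j) _))
  refine ⟨_, _, _, nn 2 1, nn 3 0, nn 0 3, ?_, ?_, ?_, ?_⟩
  · rw [← h, pow_one]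
  · rw [← h, pow_zero, Matrix.mul_one]
  · rw [← h, pow_zero, Matrix.one_mul]
  · apply mh_real _ _ _ (nn 2 1) (nn 3 0)
    intro a ha
    simp only [Finset.mul_sum, ← Finset.sum_add_distrib]
    refine Finset.sum_le_sum fun i _ => Finset.sum_le_sum fun j _ => ?_
    have key : 0 ≤ 2 * (a * p i) ^ 3 + d j ^ 3 - 3 * (a * p i) ^ 2 * d j := by
      have e : 2 * (a * p i) ^ 3 + d j ^ 3 - 3 * (a * p i) ^ 2 * d j
        = (a * p i - d j) ^ 2 * (2 * (a * p i) + d j) := by ring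
      rw [e]
      have := hp i
      have := hd j
      positivity
    nlinarith [mul_nonneg (hw i j) key]

/-- **Hölder-type estimate from the proof of Proposition `p:notclosed` (matrix case).**
For Hermitian `X₁, X₂, X₃ ∈ M_k(ℂ)`, the traces `tr(X₂X₁²X₂X₃²)`, `tr(X₁⁴X₂² + X₁²X₂⁴)`
and `tr(X₃⁶)` are nonnegative real numbers and
`4·(tr(X₂X₁²X₂X₃²))³ ≤ (tr(X₁⁴X₂² + X₁²X₂⁴))²·tr(X₃⁶)`. -/
theorem motzkin_hoelder_estimate (k : ℕ) (X₁ X₂ X₃ : Matrix (Fin k) (Fin k) ℂ)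
    (h₁ : X₁.IsHermitian) (h₂ : X₂.IsHermitian) (h₃ : X₃.IsHermitian) :
    0 ≤ Matrix.trace (X₂ * X₁ ^ 2 * X₂ * X₃ ^ 2) ∧
    0 ≤ Matrix.trace (X₁ ^ 4 * X₂ ^ 2 + X₁ ^ 2 * X₂ ^ 4) ∧
    0 ≤ Matrix.trace (X₃ ^ 6) ∧
    4 * Matrix.trace (X₂ * X₁ ^ 2 * X₂ * X₃ ^ 2) ^ 3 ≤
      Matrix.trace (X₁ ^ 4 * X₂ ^ 2 + X₁ ^ 2 * X₂ ^ 4) ^ 2 * Matrix.trace (X₃ ^ 6) := by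
  have c1 : X₁.conjTranspose = X₁ := h₁
  have c2 : X₂.conjTranspose = X₂ := h₂
  have c3 : X₃.conjTranspose = X₃ := h₃
  have tn : ∀ N : Matrix (Fin k) (Fin k) ℂ, 0 ≤ Matrix.trace (N.conjTranspose * N) := fun N =>
    (Matrix.posSemidef_conjTranspose_mul_self N).trace_nonneg
  have n2 : 0 ≤ Matrix.trace (X₁ ^ 4 * X₂ ^ 2 + X₁ ^ 2 * X₂ ^ 4) := by
    have e1 : Matrix.trace (X₁ ^ 4 * X₂ ^ 2)
        = Matrix.trace ((X₁ * X₁ * X₂).conjTranspose * (X₁ * X₁ * X₂)) := by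
      rw [show X₁ ^ 4 * X₂ ^ 2 = (X₁ * X₁ * X₁ * X₁ * X₂) * X₂ by noncomm_ring,
        Matrix.trace_mul_comm]
      simp only [Matrix.conjTranspose_mul, c1, c2, Matrix.mul_assoc]
    have e2 : Matrix.trace (X₁ ^ 2 * X₂ ^ 4)
        = Matrix.trace ((X₁ * X₂ * X₂).conjTranspose * (X₁ * X₂ * X₂)) := by
      rw [show X₁ ^ 2 * X₂ ^ 4 = (X₁ * X₁ * X₂ * X₂) * (X₂ * X₂) by noncomm_ring,
        Matrix.trace_mul_comm]
      simp only [Matrix.conjTranspose_mul, c1, c2, Matrix.mul_assoc]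
    rw [Matrix.trace_add, e1, e2]
    exact add_nonneg (tn _) (tn _)
  have hQ : (X₂ * X₁ ^ 2 * X₂).PosSemidef := by
    have := Matrix.posSemidef_conjTranspose_mul_self (X₁ * X₂)
    rw [Matrix.conjTranspose_mul, c1, c2] at this
    rwa [show X₂ * X₁ ^ 2 * X₂ = X₂ * X₁ * (X₁ * X₂) by noncomm_ring]
  have hD : (X₃ ^ 2).PosSemidef := by
    have := Matrix.posSemidef_conjTranspose_mul_self X₃
    rwa [c3, ← pow_two] at this
  obtain ⟨R, hR, hRQ⟩ := mh_sqrt _ hQ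
  obtain ⟨S, X, Y, hS, hX, hY, eS, eX, eY, hol⟩ := mh_holder R (X₃ ^ 2) hR hD
  rw [pow_two R, hRQ] at eS
  rw [← pow_mul] at eY
  have cR : R.conjTranspose = R := hR.1
  -- the arithmetic-geometric step
  have key : 0 ≤ Matrix.trace (X₁ ^ 4 * X₂ ^ 2 + X₁ ^ 2 * X₂ ^ 4) - 2 * Matrix.trace (R ^ 3) := by
    have := tn (X₂ * R - X₁ * (X₁ * X₂))
    have e : (X₂ * R - X₁ * (X₁ * X₂)).conjTranspose * (X₂ * R - X₁ * (X₁ * X₂))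
        = R * (X₂ ^ 2 * R) - R * (X₂ * X₁ ^ 2 * X₂) - (X₂ * X₁ ^ 2 * X₂) * R
          + X₂ * (X₁ ^ 4 * X₂) := by
      simp only [Matrix.conjTranspose_sub, Matrix.conjTranspose_mul, c1, c2, cR]
      noncomm_ring
    rw [e, Matrix.trace_add, Matrix.trace_sub, Matrix.trace_sub, Matrix.trace_mul_comm R,
      Matrix.trace_mul_comm X₂, Matrix.mul_assoc _ R R, hRQ] at this
    have e3 : Matrix.trace (X₂ ^ 2 * (X₂ * X₁ ^ 2 * X₂)) = Matrix.trace (X₁ ^ 2 * X₂ ^ 4) := by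
      rw [show X₂ ^ 2 * (X₂ * X₁ ^ 2 * X₂) = X₂ ^ 3 * (X₁ ^ 2 * X₂) by noncomm_ring,
        Matrix.trace_mul_comm]
      congr 1
      noncomm_ring
    have e4 : X₁ ^ 4 * X₂ * X₂ = X₁ ^ 4 * X₂ ^ 2 := by noncomm_ring
    have e5 : R * (X₂ * X₁ ^ 2 * X₂) = R ^ 3 := by rw [← hRQ]; noncomm_ring
    have e6 : (X₂ * X₁ ^ 2 * X₂) * R = R ^ 3 := by rw [← hRQ]; noncomm_ring
    rw [e3, e4, e5, e6] at this
    rw [Matrix.trace_add]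
    convert this using 1
    ring
  obtain ⟨Z, hZ⟩ : ∃ Z : ℝ, Matrix.trace (X₁ ^ 4 * X₂ ^ 2 + X₁ ^ 2 * X₂ ^ 4) = (Z : ℂ) :=
    ⟨_, (Complex.eq_re_of_ofReal_le (r := 0) (by rw [Complex.ofReal_zero]; exact n2))⟩
  rw [eX, hZ] at key
  have key' : 2 * X ≤ Z := by
    have : (0 : ℝ) ≤ Z - 2 * X := by exact_mod_cast key
    linarith
  rw [eS, hZ, eY]
  rw [hZ] at n2
  refine ⟨by exact_mod_cast hS, n2, by exact_mod_cast hY, ?_⟩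
  have fin : 4 * S ^ 3 ≤ Z ^ 2 * Y := by
    have h5 : (2 * X) ^ 2 ≤ Z ^ 2 := pow_le_pow_left₀ (by linarith) key' 2
    nlinarith [mul_le_mul_of_nonneg_right h5 hY]
  exact_mod_cast fin
end

section
/- Let r be a natural number with r ≡ 1 (mod 4) and r ≥ 5, and let ε ≥ r!/(r−1)^{r−1} be a real number. Define the real polynomial p(t) = −((t−r)/(r−1))^{(r−1)/2}. Then for every real t ≥ 0 one has 2·p(t) ≤ t − 3 and t·p(t)² ≤ 1 + (ε/r!)·t^r. -/
/-- **Lemma `l:calc`.** Let `r ≡ 1 (mod 4)`, `r ≥ 5`, and `ε ≥ r!/(r−1)^{r−1}`. The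
polynomial `p(t) = −((t−r)/(r−1))^{(r−1)/2}` satisfies `2p(t) ≤ t−3` and
`t·p(t)² ≤ 1 + (ε/r!)·t^r` for all `t ≥ 0`. -/
theorem calc_lemma (r : ℕ) (hr4 : r % 4 = 1) (hr : 5 ≤ r) (ε : ℝ)
    (hε : ε ≥ (Nat.factorial r : ℝ) / ((r : ℝ) - 1) ^ (r - 1)) :
    ∀ t : ℝ, 0 ≤ t →
      2 * (-(((t - (r : ℝ)) / ((r : ℝ) - 1)) ^ ((r - 1) / 2))) ≤ t - 3 ∧
      t * (-(((t - (r : ℝ)) / ((r : ℝ) - 1)) ^ ((r - 1) / 2))) ^ 2 ≤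
        1 + ε / (Nat.factorial r : ℝ) * t ^ r := by
  intro t ht
  obtain ⟨k, rfl⟩ : ∃ k, r = 4 * k + 1 := ⟨r / 4, by omega⟩
  have hk : 1 ≤ k := by omega
  have e1 : (4 * k + 1 - 1) / 2 = 2 * k := by omega
  have e2 : 4 * k + 1 - 1 = 4 * k := by omega
  rw [e1]
  rw [e2] at hε
  have hkR : (1 : ℝ) ≤ k := by exact_mod_cast hk
  have hc : ((4 * k + 1 : ℕ) : ℝ) = 4 * (k : ℝ) + 1 := by push_cast; ring
  rw [hc] at hε ⊢
  have hd : (4 * (k : ℝ) + 1 - 1) = 4 * k := by ring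
  rw [hd] at hε ⊢
  have hf : (0 : ℝ) < (Nat.factorial (4 * k + 1) : ℝ) := by
    exact_mod_cast Nat.factorial_pos _
  have hn : (0 : ℝ) < 4 * (k : ℝ) := by linarith
  have hε' : 1 / (4 * (k : ℝ)) ^ (4 * k) ≤ ε / (Nat.factorial (4 * k + 1) : ℝ) := by
    rw [le_div_iff₀ hf]
    calc _ = _ := by ring
      _ ≤ ε := hε
  have hcoef : 0 ≤ ε / (Nat.factorial (4 * k + 1) : ℝ) := le_trans (by positivity) hε'
  obtain ⟨x, hx⟩ : ∃ x : ℝ, x = (4 * (k : ℝ) + 1 - t) / (4 * k) := ⟨_, rfl⟩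
  have hneg : (t - (4 * (k : ℝ) + 1)) / (4 * k) = -x := by rw [hx]; ring
  have hx1 : 4 * (k : ℝ) * (x - 1) = 1 - t := by
    rw [hx]; field_simp; ring
  have hev : Even (2 * k) := even_two_mul k
  rw [hneg, hev.neg_pow]
  constructor
  · rcases le_total (-1) x with h | h
    · have hb := one_add_mul_le_pow (a := x - 1) (by linarith) (2 * k)
      have : 1 + (x - 1) = x := by ring
      rw [this] at hb
      push_cast at hb
      linarith
    · have h0 : 0 ≤ x ^ (2 * k) := hev.pow_nonneg x
      nlinarith
  · have hp : (-x ^ (2 * k)) ^ 2 = x ^ (4 * k) := by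
      rw [neg_sq, ← pow_mul]; congr 1; ring
    rw [hp]
    have hpos : 0 ≤ ε / (Nat.factorial (4 * k + 1) : ℝ) * t ^ (4 * k + 1) := by positivity
    rcases le_total 0 x with h | h
    · have h1 : x ≤ Real.exp (x - 1) := by
        have := Real.add_one_le_exp (x - 1); linarith
      have h2 : x ^ (4 * k) ≤ Real.exp (1 - t) := by
        calc x ^ (4 * k) ≤ Real.exp (x - 1) ^ (4 * k) := pow_le_pow_left₀ h h1 _
          _ = Real.exp (1 - t) := by
            rw [← Real.exp_nat_mul]; push_cast; rw [hx1]
      have h3 : t ≤ Real.exp (t - 1) := by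
        have := Real.add_one_le_exp (t - 1); linarith
      have h4 : t * x ^ (4 * k) ≤ Real.exp (t - 1) * Real.exp (1 - t) := by gcongr
      rw [← Real.exp_add] at h4
      have : t - 1 + (1 - t) = 0 := by ring
      rw [this, Real.exp_zero] at h4
      linarith
    · have h1 : -x ≤ t / (4 * k) := by
        rw [le_div_iff₀ hn]; nlinarith
      have hev4 : Even (4 * k) := ⟨2 * k, by ring⟩
      have h2 : x ^ (4 * k) ≤ (t / (4 * k)) ^ (4 * k) := by
        rw [← hev4.neg_pow]
        exact pow_le_pow_left₀ (by linarith) h1 _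
      calc t * x ^ (4 * k) ≤ t * (t / (4 * k)) ^ (4 * k) := by gcongr
        _ = 1 / (4 * (k : ℝ)) ^ (4 * k) * t ^ (4 * k + 1) := by
          rw [div_pow, pow_succ t]; ring
        _ ≤ ε / (Nat.factorial (4 * k + 1) : ℝ) * t ^ (4 * k + 1) := by gcongr
        _ ≤ _ := by linarith
end

section
/- Let M = t₁⁴t₂² + t₁²t₂⁴ − 3t₁²t₂² + 1 ∈ ℝ[t₁,t₂] be the Motzkin polynomial. Let r be a natural number with r ≡ 1 (mod 4) and r ≥ 5, and let ε ≥ r!/(r−1)^{r−1} be a real number. Then M + (ε/r!)·t₁^{2r} is a sum of squares of polynomials in ℝ[t₁,t₂]. -/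
open MvPolynomial

lemma uni_sos_aux (d : ℕ) : ∀ p : Polynomial ℝ, p.natDegree ≤ d → (∀ x, 0 ≤ p.eval x) →
    IsSumSq p := by
  induction d using Nat.strong_induction_on with
  | _ d ih =>
  intro p hd hp
  obtain ⟨a, ha⟩ := p.exists_forall_norm_le
  have hmin : ∀ x, p.eval a ≤ p.eval x := by
    intro x
    have := ha x
    rwa [Real.norm_of_nonneg (hp _), Real.norm_of_nonneg (hp _)] at this
  have hC : IsSumSq (Polynomial.C (p.eval a) : Polynomial ℝ) := by
    have : (Polynomial.C (p.eval a) : Polynomial ℝ)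
        = Polynomial.C (√(p.eval a)) * Polynomial.C (√(p.eval a)) := by
      rw [← Polynomial.C_mul, Real.mul_self_sqrt (hp a)]
    rw [this]
    exact IsSumSq.mul_self _
  obtain ⟨q, hq⟩ : (Polynomial.X - Polynomial.C a) ∣ p - Polynomial.C (p.eval a) := by
    rw [Polynomial.dvd_iff_isRoot]; simp
  have hp1 : p = Polynomial.C (p.eval a) + (Polynomial.X - Polynomial.C a) * q := by
    rw [← hq]; ring
  have hder : q.eval a = 0 := by
    have hl : IsLocalMin (fun x => p.eval x) a := Filter.Eventually.of_forall hmin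
    have h1 := hl.hasDerivAt_eq_zero (p.hasDerivAt a)
    have h2 := congrArg (fun s => (Polynomial.derivative s).eval a) hq
    simp at h2
    rw [← h2, h1]
  obtain ⟨s, hs⟩ : (Polynomial.X - Polynomial.C a) ∣ q := by
    rw [Polynomial.dvd_iff_isRoot]; exact hder
  have hp2 : p = Polynomial.C (p.eval a)
      + (Polynomial.X - Polynomial.C a) * (Polynomial.X - Polynomial.C a) * s := by
    rw [mul_assoc, ← hs]; exact hp1
  by_cases hs0 : s = 0
  · rw [hp2, hs0]; simpa using hC
  have hdeg : s.natDegree + 2 ≤ p.natDegree := by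
    have h3 : p.natDegree = (p - Polynomial.C (p.eval a)).natDegree := by simp
    have hx : (Polynomial.X - Polynomial.C a) ≠ 0 := Polynomial.X_sub_C_ne_zero a
    rw [h3, hq, hs, Polynomial.natDegree_mul hx (mul_ne_zero hx hs0),
      Polynomial.natDegree_mul hx hs0, Polynomial.natDegree_X_sub_C]
    omega
  have hoff : ∀ x, x ≠ a → 0 ≤ s.eval x := by
    intro x hx
    have h4 := congrArg (fun s => s.eval x) hp2
    simp at h4
    have h5 := hmin x
    have h6 : 0 < (x - a) * (x - a) := mul_self_pos.2 (sub_ne_zero.2 hx)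
    have h7 : 0 ≤ (x - a) * (x - a) * s.eval x := by linarith
    exact nonneg_of_mul_nonneg_right h7 h6
  have hsn : ∀ x, 0 ≤ s.eval x := by
    have hcl : IsClosed {x : ℝ | 0 ≤ s.eval x} := isClosed_le continuous_const s.continuous
    have hde : Dense ({a}ᶜ : Set ℝ) := dense_compl_singleton a
    intro x
    have := closure_minimal (s := ({a}ᶜ : Set ℝ)) (fun y hy => hoff y hy) hcl
    exact this (hde x)
  have hsos := ih (d - 1) (by omega) s (by omega) hsn
  rw [hp2]
  exact hC.add ((IsSumSq.mul_self _).mul hsos)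

lemma uni_sos (p : Polynomial ℝ) (hp : ∀ x, 0 ≤ p.eval x) :
    IsSumSq (Polynomial.aeval (X 0 : MvPolynomial (Fin 2) ℝ) p) := by
  have h := uni_sos_aux _ p le_rfl hp
  clear hp
  induction h with
  | zero => rw [map_zero]; exact IsSumSq.zero
  | sq_add a hs ih => rw [map_add, map_mul]; exact IsSumSq.sq_add _ ih

lemma bern (n : ℕ) (hn : Even n) (z : ℝ) : 1 + n * z ≤ (1 + z) ^ n := by
  by_cases h : -2 ≤ z
  · exact one_add_mul_le_pow h n
  · rcases Nat.eq_zero_or_pos n with rfl | h0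
    · simp
    have : (1 : ℝ) ≤ n := by exact_mod_cast h0
    have := hn.pow_nonneg (1 + z)
    nlinarith

lemma amgm (m : ℕ) (hm : Even m) (hm0 : 0 < m) (x w : ℝ) (hw : x = m + 1 - m * w) (hx : 0 ≤ x) :
    x * w ^ m ≤ 1 + x ^ (m + 1) / (m : ℝ) ^ m := by
  have hmr : (0 : ℝ) < m := by exact_mod_cast hm0
  rcases le_or_gt w 0 with h | h
  · have h1 : w ^ m ≤ (x / m) ^ m := by
      rw [← hm.neg_pow w]
      apply pow_le_pow_left₀ (by linarith)
      rw [le_div_iff₀ hmr]; linarith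
    have h2 : x * w ^ m ≤ x * (x / m) ^ m := mul_le_mul_of_nonneg_left h1 hx
    have h3 : x * (x / m) ^ m = x ^ (m + 1) / (m : ℝ) ^ m := by
      rw [div_pow, pow_succ]; ring
    linarith
  · have h1 : 1 + ((m + 1 : ℕ) : ℝ) * (1 / w - 1) ≤ (1 + (1 / w - 1)) ^ (m + 1) :=
      one_add_mul_le_pow (by have : 0 < 1 / w := by positivity
                             linarith) _
    have h2 := mul_le_mul_of_nonneg_right h1 (pow_pos h (m + 1)).le
    have h3 : (1 + (1 / w - 1)) ^ (m + 1) * w ^ (m + 1) = 1 := by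
      rw [← mul_pow]; field_simp; simp
    have h4 : (1 + ((m + 1 : ℕ) : ℝ) * (1 / w - 1)) * w ^ (m + 1) = x * w ^ m := by
      rw [hw]; push_cast; field_simp; ring
    have : 0 ≤ x ^ (m + 1) / (m : ℝ) ^ m := by positivity
    linarith

theorem motzkin_perturbation_sos (r : ℕ) (hr4 : r % 4 = 1) (hr : 5 ≤ r) (ε : ℝ)
    (hε : ε ≥ (Nat.factorial r : ℝ) / ((r : ℝ) - 1) ^ (r - 1)) :
    IsSumSq ((X 0 ^ 4 * X 1 ^ 2 + X 0 ^ 2 * X 1 ^ 4 - 3 * (X 0 ^ 2 * X 1 ^ 2) + 1 :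
        MvPolynomial (Fin 2) ℝ) + C (ε / (Nat.factorial r : ℝ)) * X 0 ^ (2 * r)) := by
  obtain ⟨n, rfl⟩ : ∃ n, r = 2 * n + 1 := ⟨r / 2, by omega⟩
  have hne : Even n := by rw [Nat.even_iff]; omega
  have hn0 : 0 < n := by omega
  have hnr : (0 : ℝ) < n := by exact_mod_cast hn0
  set δ : ℝ := ε / (Nat.factorial (2 * n + 1) : ℝ) with hδ
  have hδ' : 1 / ((2 * n : ℕ) : ℝ) ^ (2 * n) ≤ δ := by
    have hf : (0 : ℝ) < (Nat.factorial (2 * n + 1) : ℝ) := by exact_mod_cast Nat.factorial_pos _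
    rw [hδ, le_div_iff₀ hf]
    have h1 : (((2 * n + 1 : ℕ) : ℝ) - 1) = ((2 * n : ℕ) : ℝ) := by push_cast; ring
    rw [h1, Nat.add_sub_cancel] at hε
    rw [one_div_mul_eq_div]; exact hε
  set w : Polynomial ℝ := Polynomial.C (1 / (2 * n : ℝ)) *
    (Polynomial.C (2 * n + 1 : ℝ) - Polynomial.X ^ 2) with hw
  have hB := uni_sos (Polynomial.X ^ 4 - 3 * Polynomial.X ^ 2
      + 2 * Polynomial.X ^ 2 * w ^ n) (by
    intro t
    have hb := bern n hne (1 / (2 * n : ℝ) * (2 * n + 1 - t ^ 2) - 1)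
    have h1 : 1 + (n : ℝ) * (1 / (2 * n : ℝ) * (2 * n + 1 - t ^ 2) - 1) = (3 - t ^ 2) / 2 := by
      field_simp; ring
    rw [h1, add_sub_cancel] at hb
    have h2 := mul_le_mul_of_nonneg_left hb (sq_nonneg t)
    simp only [hw, Polynomial.eval_add, Polynomial.eval_sub, Polynomial.eval_mul,
      Polynomial.eval_pow, Polynomial.eval_X, Polynomial.eval_C, Polynomial.eval_ofNat]
    nlinarith)
  have hD := uni_sos (1 + Polynomial.C δ * Polynomial.X ^ (2 * (2 * n + 1))
      - Polynomial.X ^ 2 * w ^ (2 * n)) (by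
    intro t
    have hb := amgm (2 * n) (even_two_mul n) (by omega) (t ^ 2)
      (1 / (2 * n : ℝ) * (2 * n + 1 - t ^ 2)) (by push_cast; field_simp; ring) (sq_nonneg t)
    have h2 := mul_le_mul_of_nonneg_right hδ' (pow_nonneg (sq_nonneg t) (2 * n + 1))
    rw [one_div_mul_eq_div] at h2
    simp only [hw, Polynomial.eval_add, Polynomial.eval_sub, Polynomial.eval_mul,
      Polynomial.eval_pow, Polynomial.eval_X, Polynomial.eval_C, Polynomial.eval_one]
    rw [pow_mul t 2 (2 * n + 1)]
    linarith)
  set W := Polynomial.aeval (X 0 : MvPolynomial (Fin 2) ℝ) w with hW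
  simp only [map_add, map_sub, map_mul, map_pow, Polynomial.aeval_X, Polynomial.aeval_C, map_one,
    map_ofNat, ← hW] at hB hD
  rw [MvPolynomial.algebraMap_eq] at hD
  have key := ((IsSumSq.mul_self (X 0 * X 1 ^ 2 - X 0 * W ^ n : MvPolynomial (Fin 2) ℝ)).add
    ((IsSumSq.mul_self (X 1 : MvPolynomial (Fin 2) ℝ)).mul hB)).add hD
  have heq : (X 0 ^ 4 * X 1 ^ 2 + X 0 ^ 2 * X 1 ^ 4 - 3 * (X 0 ^ 2 * X 1 ^ 2) + 1 :
        MvPolynomial (Fin 2) ℝ) + C δ * X 0 ^ (2 * (2 * n + 1)) =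
      (X 0 * X 1 ^ 2 - X 0 * W ^ n) * (X 0 * X 1 ^ 2 - X 0 * W ^ n) +
        X 1 * X 1 * (X 0 ^ 4 - 3 * X 0 ^ 2 + 2 * X 0 ^ 2 * W ^ n) +
      (1 + C δ * X 0 ^ (2 * (2 * n + 1)) - X 0 ^ 2 * W ^ (2 * n)) := by
    rw [pow_mul' W 2 n]
    ring
  rw [heq]
  exact key
end

section
/- Let m = x₂x₁⁴x₂ + x₂²x₁²x₂² − 3x₂x₁²x₂ + 1 ∈ ℝ⟨x₁,x₂⟩. Let r be a natural number with r ≡ 1 (mod 4) and r ≥ 5, and let ε ≥ r!/(r−1)^{r−1} be a real number. Then there exist finitely many s₁,…,s_ℓ ∈ ℝ⟨x₁,x₂⟩ such that m + (ε/r!)·x₁^{2r} − (s₁s₁* + ⋯ + s_ℓs_ℓ*) lies in Θ, the linear span of commutators. -/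
/-- The linear span of commutators `[p, q] = p*q - q*p` in the free real `*`-algebra. -/
def thetaCommutators (n : ℕ) : Submodule ℝ (FreeAlgebra ℝ (Fin n)) :=
  Submodule.span ℝ
    {c : FreeAlgebra ℝ (Fin n) | ∃ p q : FreeAlgebra ℝ (Fin n), c = p * q - q * p}

open Polynomial in
/-- A real univariate polynomial that is nonnegative everywhere is a sum of squares. -/
theorem univ_sos (N : ℕ) : ∀ p : ℝ[X], p.natDegree ≤ N → (∀ x, 0 ≤ p.eval x) →
    ∃ l : List ℝ[X], p = (l.map fun s => s * s).sum := by
  have hconst : ∀ c : ℝ, 0 ≤ c → (C c : ℝ[X]) = C (√c) * C (√c) := by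
    intro c hc
    rw [← C_mul, Real.mul_self_sqrt hc]
  induction N using Nat.strong_induction_on with
  | _ N ih =>
  intro p hpN hp
  by_cases hd : p.natDegree = 0
  · obtain ⟨c, rfl⟩ := natDegree_eq_zero.mp hd
    have hc : 0 ≤ c := by simpa using hp 0
    exact ⟨[C (√c)], by simpa using hconst c hc⟩
  · have hdeg : 0 < p.degree := natDegree_pos_iff_degree_pos.mp (Nat.pos_of_ne_zero hd)
    have ht : Filter.Tendsto (fun x => p.eval x) (Filter.cocompact ℝ) Filter.atTop := by
      have := p.tendsto_norm_atTop hdeg (tendsto_norm_cocompact_atTop (E := ℝ))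
      refine this.congr fun x => ?_
      rw [Real.norm_eq_abs, abs_of_nonneg (hp x)]
    obtain ⟨a, ha⟩ := p.continuous.exists_forall_le ht
    have hroot : (p - C (p.eval a)).IsRoot a := by simp
    obtain ⟨q₁, hq₁⟩ := dvd_iff_isRoot.mpr hroot
    have hder : q₁.eval a = 0 := by
      have hmin : IsLocalMin (fun x => p.eval x) a := Filter.Eventually.of_forall ha
      have h0 := hmin.hasDerivAt_eq_zero (p.hasDerivAt a)
      have h1 := congrArg (fun f => (derivative f).eval a) hq₁
      simp at h1
      linarith
    obtain ⟨q, hq⟩ := dvd_iff_isRoot.mpr (show q₁.IsRoot a from hder)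
    have hpq : p = C (p.eval a) + (X - C a) * (X - C a) * q := by
      rw [mul_assoc, ← hq, ← hq₁]; ring
    have hq0' : ∀ x, x ≠ a → 0 ≤ q.eval x := by
      intro x hx
      have h2 := ha x
      have h1 := congrArg (fun f => f.eval x) hpq
      simp only [eval_add, eval_mul, eval_sub, eval_C, eval_X] at h1
      have h3 : 0 < (x - a) * (x - a) := mul_self_pos.mpr (sub_ne_zero.mpr hx)
      exact nonneg_of_mul_nonneg_right (by linarith) h3
    have hq0 : ∀ x, 0 ≤ q.eval x := by
      have hcl : IsClosed {x | 0 ≤ q.eval x} := isClosed_le continuous_const q.continuous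
      have hd : Dense ({a}ᶜ : Set ℝ) := dense_compl_singleton a
      have hsub : closure ({a}ᶜ : Set ℝ) ⊆ {x | 0 ≤ q.eval x} :=
        hcl.closure_subset_iff.mpr fun x hx => hq0' x hx
      intro x
      exact hsub (hd x)
    have hqd : q.natDegree < N := by
      by_cases hqz : q = 0
      · subst hqz; simp; omega
      · have hne : (X - C a : ℝ[X]) ≠ 0 := X_sub_C_ne_zero a
        have h1 : (p - C (p.eval a)).natDegree = p.natDegree := natDegree_sub_C
        rw [hq₁, hq, natDegree_mul hne (mul_ne_zero hne hqz), natDegree_mul hne hqz,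
          natDegree_X_sub_C] at h1
        omega
    obtain ⟨l, hl⟩ := ih _ hqd q le_rfl hq0
    refine ⟨C (√(p.eval a)) :: l.map fun s => (X - C a) * s, ?_⟩
    rw [List.map_cons, List.sum_cons, ← hconst _ (hp a), List.map_map]
    have : ((fun s : ℝ[X] => s * s) ∘ fun s => (X - C a) * s)
        = fun s => ((X - C a) * (X - C a)) * (s * s) := by
      funext s; simp; ring
    rw [this, List.sum_map_mul_left, ← hl]
    exact hpq

theorem amgm_aux (b : ℝ) (hb : 0 ≤ b) (n : ℕ) : b ^ n * (n + 1 - n * b) ≤ 1 := by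
  induction n with
  | zero => simp
  | succ n ih =>
    have h : 0 ≤ b ^ n * ((n + 1) * (b - 1) ^ 2) := by positivity
    push_cast
    rw [pow_succ]
    nlinarith

theorem star_aeval_x (s : Polynomial ℝ) :
    star (Polynomial.aeval (FreeAlgebra.ι ℝ (0 : Fin 2)) s)
      = Polynomial.aeval (FreeAlgebra.ι ℝ (0 : Fin 2)) s := by
  induction s using Polynomial.induction_on' with
  | add p q hp hq => simp [hp, hq]
  | monomial n a =>
    simp only [Polynomial.aeval_monomial, star_mul, star_pow, FreeAlgebra.star_ι,
      FreeAlgebra.star_algebraMap]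
    exact (Algebra.commutes _ _).symm

theorem g_ge (u : ℝ) (l : ℕ) : 1 + 2 * l * (u - 1) ≤ u ^ (2 * l) := by
  have h := one_add_mul_le_pow (a := u ^ 2 - 1) (by nlinarith [sq_nonneg u]) l
  rw [pow_mul]
  have e : 1 + (u ^ 2 - 1) = u ^ 2 := by ring
  rw [e] at h
  have : 0 ≤ (l : ℝ) * (u - 1) ^ 2 := by positivity
  nlinarith

theorem rem_nonneg (l : ℕ) (hl : 1 ≤ l) (δ : ℝ) (hδ : 1 / (4 * l : ℝ) ^ (4 * l) ≤ δ) (t : ℝ)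
    (ht : 0 ≤ t) :
    0 ≤ 1 + δ * t ^ (4 * l + 1) - t * ((4 * l + 1 - t) / (4 * l)) ^ (4 * l) := by
  have hl0 : (0 : ℝ) < 4 * l := by positivity
  have hδ0 : 0 ≤ δ := le_trans (by positivity) hδ
  rcases le_total t (4 * l + 1) with h | h
  · have := amgm_aux ((4 * l + 1 - t) / (4 * l)) (div_nonneg (by linarith) hl0.le) (4 * l)
    have e : ((4 * l : ℕ) : ℝ) + 1 - ((4 * l : ℕ) : ℝ) * ((4 * l + 1 - t) / (4 * l)) = t := by
      push_cast; field_simp; ring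
    rw [e] at this
    have : 0 ≤ δ * t ^ (4 * l + 1) := by positivity
    linarith
  · have ev : Even (4 * l) := ⟨2 * l, by ring⟩
    have h1 : (4 * l + 1 - t) ^ (4 * l) ≤ t ^ (4 * l) := by
      rw [← ev.neg_pow]
      exact pow_le_pow_left₀ (by linarith) (by linarith) _
    have h2 : t * ((4 * l + 1 - t) / (4 * l)) ^ (4 * l)
        ≤ 1 / (4 * l : ℝ) ^ (4 * l) * t ^ (4 * l + 1) := by
      rw [div_pow, pow_succ]
      calc _ ≤ t * (t ^ (4 * l) / (4 * l) ^ (4 * l)) := by gcongr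
        _ = _ := by ring
    have h3 : 1 / (4 * l : ℝ) ^ (4 * l) * t ^ (4 * l + 1) ≤ δ * t ^ (4 * l + 1) := by gcongr
    linarith

theorem comm_mem (p q : FreeAlgebra ℝ (Fin 2)) : p * q - q * p ∈ thetaCommutators 2 :=
  Submodule.subset_span ⟨p, q, rfl⟩

/-- **Example `ex:lass` (noncommutative part).** Let
`m = x₂x₁⁴x₂ + x₂²x₁²x₂² − 3x₂x₁²x₂ + 1 ∈ ℝ⟨x₁,x₂⟩`. If `r ≡ 1 (mod 4)`, `r ≥ 5` and
`ε ≥ r!/(r−1)^{r−1}`, then `m + (ε/r!)·x₁^{2r}` is, up to an element of `Θ`, a sum of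
hermitian squares. -/
theorem nc_motzkin_perturbation_sohs (r : ℕ) (hr4 : r % 4 = 1) (hr : 5 ≤ r) (ε : ℝ)
    (hε : ε ≥ (Nat.factorial r : ℝ) / ((r : ℝ) - 1) ^ (r - 1)) :
    ∃ l : List (FreeAlgebra ℝ (Fin 2)),
      (FreeAlgebra.ι ℝ (1 : Fin 2) * FreeAlgebra.ι ℝ (0 : Fin 2) ^ 4 *
            FreeAlgebra.ι ℝ (1 : Fin 2) +
          FreeAlgebra.ι ℝ (1 : Fin 2) ^ 2 * FreeAlgebra.ι ℝ (0 : Fin 2) ^ 2 *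
            FreeAlgebra.ι ℝ (1 : Fin 2) ^ 2 -
          3 * (FreeAlgebra.ι ℝ (1 : Fin 2) * FreeAlgebra.ι ℝ (0 : Fin 2) ^ 2 *
            FreeAlgebra.ι ℝ (1 : Fin 2)) + 1) +
        (ε / (Nat.factorial r : ℝ)) • FreeAlgebra.ι ℝ (0 : Fin 2) ^ (2 * r) -
        (l.map fun s => s * star s).sum ∈ thetaCommutators 2 := by
  obtain ⟨l, rfl⟩ : ∃ l, r = 4 * l + 1 := ⟨r / 4, by omega⟩
  have hl : 1 ≤ l := by omega
  have hl0 : (0 : ℝ) < 4 * l := by positivity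
  set δ : ℝ := ε / (Nat.factorial (4 * l + 1) : ℝ) with hδdef
  have hδ : 1 / (4 * l : ℝ) ^ (4 * l) ≤ δ := by
    have hf : (0 : ℝ) < (Nat.factorial (4 * l + 1) : ℝ) := by positivity
    rw [hδdef, le_div_iff₀ hf]
    have e : ((4 * l + 1 : ℕ) : ℝ) - 1 = 4 * l := by push_cast; ring
    rw [e, Nat.add_sub_cancel] at hε
    calc _ = (Nat.factorial (4 * l + 1) : ℝ) / (4 * l : ℝ) ^ (4 * l) := by ring
      _ ≤ ε := hε
  clear_value δ
  let G : Polynomial ℝ := (Polynomial.C (1 / (4 * l : ℝ)) *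
    (Polynomial.C (4 * l + 1 : ℝ) - Polynomial.X ^ 2)) ^ (2 * l)
  have hG : ∀ x : ℝ, G.eval x = ((4 * l + 1 - x ^ 2) / (4 * l)) ^ (2 * l) := by
    intro x
    simp only [G, Polynomial.eval_pow, Polynomial.eval_mul, Polynomial.eval_sub,
      Polynomial.eval_C, Polynomial.eval_X]
    congr 1
    ring
  clear_value G
  obtain ⟨lh, hlh⟩ := univ_sos _ (Polynomial.X ^ 2 * (2 * G - 3 + Polynomial.X ^ 2)) le_rfl (by
    intro x
    have h := g_ge ((4 * l + 1 - x ^ 2) / (4 * l)) l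
    simp only [Polynomial.eval_mul, Polynomial.eval_add, Polynomial.eval_sub,
      Polynomial.eval_pow, Polynomial.eval_X, Polynomial.eval_ofNat, hG]
    have e : 1 + 2 * l * ((4 * l + 1 - x ^ 2) / (4 * l) - 1) = (3 - x ^ 2) / 2 := by
      field_simp; ring
    rw [e] at h
    exact mul_nonneg (sq_nonneg x) (by linarith))
  obtain ⟨lf, hlf⟩ := univ_sos _ (1 + Polynomial.C δ * Polynomial.X ^ (2 * (4 * l + 1))
      - Polynomial.X ^ 2 * G ^ 2) le_rfl (by
    intro x
    have h := rem_nonneg l hl δ hδ (x ^ 2) (sq_nonneg x)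
    simp only [Polynomial.eval_mul, Polynomial.eval_add, Polynomial.eval_sub,
      Polynomial.eval_pow, Polynomial.eval_X, Polynomial.eval_one, Polynomial.eval_C, hG]
    rw [← pow_mul] at h
    rw [← pow_mul, show 2 * l * 2 = 4 * l by ring]
    exact h)
  set x := FreeAlgebra.ι ℝ (0 : Fin 2) with hx
  set y := FreeAlgebra.ι ℝ (1 : Fin 2) with hy
  have sx : star x = x := FreeAlgebra.star_ι _
  have sy : star y = y := FreeAlgebra.star_ι _
  have hst : ∀ s, star (Polynomial.aeval x s) = Polynomial.aeval x s := star_aeval_x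
  have key : ∀ L : List (Polynomial ℝ), (L.map fun s => Polynomial.aeval x s *
      star (Polynomial.aeval x s)).sum = Polynomial.aeval x (L.map fun s => s * s).sum := by
    intro L
    rw [map_list_sum, List.map_map]
    congr 1
    refine List.map_congr_left fun s _ => ?_
    simp [hst]
  have key2 : ∀ L : List (Polynomial ℝ), (L.map fun s => (y * Polynomial.aeval x s) *
      star (y * Polynomial.aeval x s)).sum
      = y * Polynomial.aeval x (L.map fun s => s * s).sum * y := by
    intro L
    rw [← key, ← List.sum_map_mul_left, ← List.sum_map_mul_right]
    congr 1
    refine List.map_congr_left fun s _ => ?_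
    simp only [star_mul, sy, mul_assoc]
  set g := Polynomial.aeval x G with hg
  have sg : star g = g := hst G
  have cg : g * x = x * g := by
    have h := congrArg (Polynomial.aeval x) (mul_comm G Polynomial.X)
    simpa using h
  refine ⟨(x * (y ^ 2 - g)) :: ((lh.map fun s => y * Polynomial.aeval x s) ++
    lf.map fun s => Polynomial.aeval x s), ?_⟩
  have hsum : (((x * (y ^ 2 - g)) :: ((lh.map fun s => y * Polynomial.aeval x s) ++
      lf.map fun s => Polynomial.aeval x s)).map fun s => s * star s).sum
      = x * (y ^ 2 - g) * ((y ^ 2 - g) * x) + (y * (x ^ 2 * (2 * g - 3 + x ^ 2)) * y +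
        (1 + δ • x ^ (2 * (4 * l + 1)) - x ^ 2 * g ^ 2)) := by
    rw [List.map_cons, List.sum_cons, List.map_append, List.sum_append, List.map_map,
      List.map_map]
    have h1 := key2 lh
    have h2 := key lf
    rw [← hlh] at h1
    rw [← hlf] at h2
    simp only [Function.comp_def]
    rw [h1, h2]
    simp only [star_mul, star_sub, star_pow, sx, sy, sg, map_mul, map_add, map_sub, map_pow,
      Polynomial.aeval_X, Polynomial.aeval_C, map_one, map_ofNat, ← hg, Algebra.smul_def]
  rw [hsum]
  have c1 := comm_mem (x * y) (y * g * x)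
  have c2 := comm_mem (x * g * y) (y * x)
  have c3 := comm_mem (y ^ 2 * x) (x * y ^ 2)
  have c := Submodule.add_mem _ (Submodule.add_mem _ c1 c2) c3
  convert c using 1
  have e1 : x * g * (g * x) = x ^ 2 * g ^ 2 := by
    rw [cg, pow_two, pow_two, mul_assoc, mul_assoc, ← mul_assoc g x g, cg, mul_assoc]
  have e2 : y * g * x * (x * y) = y * x * (x * g * y) := by
    calc y * g * x * (x * y) = y * (g * x) * x * y := by simp only [mul_assoc]
      _ = y * x * (g * x) * y := by rw [cg, ← mul_assoc y x g, mul_assoc (y * x) g x, cg]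
      _ = _ := by rw [cg]; simp only [mul_assoc]
  have e3 : x * (y ^ 2 - g) * ((y ^ 2 - g) * x) = x * y ^ 4 * x - x * y ^ 2 * g * x
      - x * g * y ^ 2 * x + x ^ 2 * g ^ 2 := by
    rw [← e1]; noncomm_ring
  rw [e3, e2]
  noncomm_ring
end

section
/- Let m = x₂x₁⁴x₂ + x₂²x₁²x₂² − 3x₂x₁²x₂ + 1 ∈ ℝ⟨x₁,x₂⟩. Then m cannot be written as a sum of hermitian squares plus an element of Θ; that is, there do not exist s₁,…,s_ℓ ∈ ℝ⟨x₁,x₂⟩ with m − (s₁s₁* + ⋯ + s_ℓs_ℓ*) ∈ Θ. -/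
open Polynomial in
/-- Sums of squares vanish only trivially. -/
def FormallyRealList (R : Type) [CommRing R] : Prop :=
  ∀ l : List R, (l.map (fun s => s ^ 2)).sum = 0 → ∀ s ∈ l, s = 0

theorem formallyReal_real : FormallyRealList ℝ := by
  intro l
  induction l with
  | nil => simp
  | cons a l ih =>
    intro h
    have h0 : 0 ≤ (l.map (fun s => s ^ 2)).sum := by
      apply List.sum_nonneg
      intro x hx
      obtain ⟨y, _, rfl⟩ := List.mem_map.1 hx
      positivity
    simp only [List.map_cons, List.sum_cons] at h
    have h1 : a ^ 2 = 0 := by nlinarith [sq_nonneg a]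
    have h2 : (l.map (fun s => s ^ 2)).sum = 0 := by linarith
    intro s hs
    rcases List.mem_cons.1 hs with rfl | hs
    · exact pow_eq_zero_iff (two_ne_zero) |>.1 h1
    · exact ih h2 s hs

open Polynomial in
theorem coeff_sum_sq {R : Type} [CommRing R] (l : List R[X]) (n : ℕ)
    (h : ∀ p ∈ l, p.natDegree ≤ n) :
    ((l.map (fun s => s ^ 2)).sum).coeff (2 * n) =
      ((l.map (fun p => p.coeff n)).map (fun s => s ^ 2)).sum := by
  induction l with
  | nil => simp
  | cons a l ih =>
    simp only [List.map_cons, List.sum_cons, coeff_add]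
    rw [ih (fun p hp => h p (List.mem_cons_of_mem _ hp)),
      coeff_pow_of_natDegree_le (h a List.mem_cons_self)]

open Polynomial in
theorem natDegree_le_of_sum_sq {R : Type} [CommRing R] (hR : FormallyRealList R)
    (l : List R[X]) (n : ℕ)
    (h : ∀ k, 2 * n < k → ((l.map (fun s => s ^ 2)).sum).coeff k = 0) :
    ∀ p ∈ l, p.natDegree ≤ n := by
  have key : ∀ d, (∀ p ∈ l, p.natDegree ≤ n + d) → ∀ p ∈ l, p.natDegree ≤ n := by
    intro d
    induction d with
    | zero => intro h; exact h
    | succ d ih =>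
      intro hd
      apply ih
      intro p hp
      have h1 := coeff_sum_sq l _ hd
      rw [h _ (by omega)] at h1
      have h2 := hR _ h1.symm (p.coeff (n + (d + 1))) (List.mem_map_of_mem hp)
      have h3 := hd p hp
      rw [natDegree_le_iff_coeff_eq_zero] at h3 ⊢
      intro N hN
      rcases Nat.lt_or_ge (n + (d + 1)) N with h4 | h4
      · exact h3 N h4
      · have : N = n + (d + 1) := by omega
        rw [this, h2]
  apply key (l.map natDegree).sum
  intro p hp
  have := List.le_sum_of_mem (List.mem_map_of_mem (f := natDegree) hp)
  omega

open Polynomial in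
theorem formallyReal_poly {R : Type} [CommRing R] (hR : FormallyRealList R) :
    FormallyRealList R[X] := by
  intro l h p hp
  have hd := natDegree_le_of_sum_sq hR l 0 (by simp [h])
  have h1 := coeff_sum_sq l 0 hd
  rw [h, coeff_zero] at h1
  have h2 := hR _ h1.symm (p.coeff 0) (List.mem_map_of_mem hp)
  rw [eq_C_of_natDegree_le_zero (hd p hp), h2, C_0]

open Polynomial in
theorem coeff_zero_sum_sq {R : Type} [CommRing R] (l : List R[X]) :
    ((l.map (fun s => s ^ 2)).sum).coeff 0 =
      ((l.map (fun p => p.coeff 0)).map (fun s => s ^ 2)).sum := by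
  induction l with
  | nil => simp
  | cons a l ih =>
    simp only [List.map_cons, List.sum_cons, coeff_add]
    rw [ih, pow_two, mul_coeff_zero, pow_two]

open Polynomial in
theorem motzkin_comm (l : List ℝ[X][X])
    (h : (l.map (fun s => s ^ 2)).sum =
      C (X ^ 2) * X ^ 4 + C (X ^ 4 - 3 * X ^ 2) * X ^ 2 + 1) : False := by
  have hR := formallyReal_real
  have hP := formallyReal_poly hR
  -- degree in the outer variable
  have hd : ∀ p ∈ l, p.natDegree ≤ 2 := by
    apply natDegree_le_of_sum_sq hP
    intro k hk
    rw [h]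
    simp only [coeff_add, coeff_C_mul, coeff_X_pow, coeff_one]
    rw [if_neg (by omega), if_neg (by omega), if_neg (by omega)]
    simp
  have h2 := coeff_sum_sq l 2 hd
  rw [h] at h2
  have hd2 : ∀ p ∈ l, (p.coeff 2).natDegree ≤ 1 := by
    intro p hp
    refine natDegree_le_of_sum_sq hR _ 1 ?_ _ (List.mem_map_of_mem (f := fun p => p.coeff 2) hp)
    intro k hk
    rw [← h2]
    simp only [coeff_add, coeff_C_mul, coeff_X_pow, coeff_one]
    norm_num [coeff_X_pow]
    omega
  have h0 := coeff_zero_sum_sq l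
  rw [h] at h0
  have hd0 : ∀ p ∈ l, (p.coeff 0).natDegree ≤ 0 := by
    intro p hp
    refine natDegree_le_of_sum_sq hR _ 0 ?_ _ (List.mem_map_of_mem (f := fun p => p.coeff 0) hp)
    intro k hk
    rw [← h0]
    simp only [coeff_add, coeff_C_mul, coeff_X_pow, coeff_one]
    norm_num
    simp [coeff_one]
    omega
  have he : ∀ p ∈ l, (p.map (evalRingHom (0 : ℝ))).natDegree ≤ 0 := by
    intro p hp
    refine natDegree_le_of_sum_sq hR (l.map (fun p => p.map (evalRingHom (0 : ℝ)))) 0 ?_ _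
      (List.mem_map_of_mem (f := fun p => p.map (evalRingHom (0 : ℝ))) hp)
    intro k hk
    have h3 := congrArg (mapRingHom (evalRingHom (0 : ℝ))) h
    rw [map_list_sum, List.map_map] at h3
    rw [List.map_map]
    have h4 : ((fun s : ℝ[X] => s ^ 2) ∘ fun p : ℝ[X][X] => p.map (evalRingHom (0 : ℝ))) =
        (mapRingHom (evalRingHom (0 : ℝ)) ∘ fun s => s ^ 2) := by
      funext p; simp
    rw [h4, h3]
    have hk0 : k ≠ 0 := by omega
    simp [coeff_one, hk0]
  have hc : (((l.map (fun s => s ^ 2)).sum).coeff 2).coeff 2 = -3 := by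
    rw [h]
    simp only [coeff_add, coeff_C_mul, coeff_X_pow, coeff_one]
    have h3 : (3 : ℝ[X]) = C 3 := (map_ofNat C 3).symm
    rw [h3]
    norm_num [coeff_X_pow, coeff_C_mul]
  have hnn : ∀ p ∈ l, 0 ≤ ((p ^ 2).coeff 2).coeff 2 := by
    intro p hp
    have a1 : (p.coeff 0).coeff 1 = 0 := coeff_eq_zero_of_natDegree_lt (by have := hd0 p hp; omega)
    have a2 : (p.coeff 0).coeff 2 = 0 := coeff_eq_zero_of_natDegree_lt (by have := hd0 p hp; omega)
    have a3 : (p.coeff 2).coeff 2 = 0 := coeff_eq_zero_of_natDegree_lt (by have := hd2 p hp; omega)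
    have a4 : (p.coeff 1).coeff 0 = 0 := by
      have : (p.map (evalRingHom (0 : ℝ))).coeff 1 = 0 :=
        coeff_eq_zero_of_natDegree_lt (by have := he p hp; omega)
      rw [coeff_map] at this
      simpa [coeff_zero_eq_eval_zero] using this
    have : ((p ^ 2).coeff 2).coeff 2 = ((p.coeff 1).coeff 1) ^ 2 := by
      have e : Finset.HasAntidiagonal.antidiagonal 2 = {((0 : ℕ), (2 : ℕ)), (1, 1), (2, 0)} := by decide
      simp [pow_two p, coeff_mul, e, a1, a2, a3, a4]
      ring
    rw [this]; positivity
  have hfin : 0 ≤ (((l.map (fun s => s ^ 2)).sum).coeff 2).coeff 2 := by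
    clear hc he h0 hd0 hd2 h2 hd h
    induction l with
    | nil => simp
    | cons a l ih =>
      simp only [List.map_cons, List.sum_cons, coeff_add]
      exact add_nonneg (hnn a List.mem_cons_self)
        (ih (fun p hp => hnn p (List.mem_cons_of_mem _ hp)))
  rw [hc] at hfin
  norm_num at hfin

open Polynomial in
/-- The commutative collapse. -/
noncomputable def collapse : FreeAlgebra ℝ (Fin 2) →ₐ[ℝ] ℝ[X][X] :=
  FreeAlgebra.lift ℝ (fun i : Fin 2 => if i = 0 then (X : ℝ[X][X]) else C X)

theorem collapse_star (s : FreeAlgebra ℝ (Fin 2)) : collapse (star s) = collapse s := by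
  induction s using FreeAlgebra.induction with
  | grade0 r => simp
  | grade1 i => simp
  | mul a b ha hb => rw [star_mul, map_mul, map_mul, ha, hb, mul_comm]
  | add a b ha hb => rw [star_add, map_add, map_add, ha, hb]

theorem collapse_theta (c : FreeAlgebra ℝ (Fin 2)) (hc : c ∈ thetaCommutators 2) :
    collapse c = 0 := by
  have : thetaCommutators 2 ≤ LinearMap.ker collapse.toLinearMap := by
    unfold thetaCommutators
    rw [Submodule.span_le]
    rintro _ ⟨p, q, rfl⟩
    simp [mul_comm]
  exact this hc

/-- **From Example `ex:motzkin`.** The noncommutative lift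
`m = x₂x₁⁴x₂ + x₂²x₁²x₂² − 3x₂x₁²x₂ + 1` of the Motzkin polynomial is not a sum of
hermitian squares plus an element of `Θ`. -/
theorem nc_motzkin_not_sohs_plus_commutators :
    ¬ ∃ l : List (FreeAlgebra ℝ (Fin 2)),
      (FreeAlgebra.ι ℝ (1 : Fin 2) * FreeAlgebra.ι ℝ (0 : Fin 2) ^ 4 *
            FreeAlgebra.ι ℝ (1 : Fin 2) +
          FreeAlgebra.ι ℝ (1 : Fin 2) ^ 2 * FreeAlgebra.ι ℝ (0 : Fin 2) ^ 2 *
            FreeAlgebra.ι ℝ (1 : Fin 2) ^ 2 -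
          3 * (FreeAlgebra.ι ℝ (1 : Fin 2) * FreeAlgebra.ι ℝ (0 : Fin 2) ^ 2 *
            FreeAlgebra.ι ℝ (1 : Fin 2)) + 1) -
        (l.map fun s => s * star s).sum ∈ thetaCommutators 2 := by
  rintro ⟨l, hl⟩
  have h := collapse_theta _ hl
  rw [map_sub, sub_eq_zero, map_list_sum, List.map_map] at h
  apply motzkin_comm (l.map collapse)
  rw [List.map_map]
  have h4 : (collapse ∘ fun s => s * star s) = ((fun s => s ^ 2) ∘ collapse) := by
    funext s
    simp [collapse_star, pow_two]
  rw [h4] at h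
  rw [← h]
  have h3 : (3 : FreeAlgebra ℝ (Fin 2)) = 1 + 1 + 1 := by norm_num
  have h3' : (3 : Polynomial ℝ) = 1 + 1 + 1 := by norm_num
  rw [h3, h3']
  simp only [collapse, map_add, map_sub, map_mul, map_pow, map_one, FreeAlgebra.lift_ι_apply]
  simp only [if_true, one_ne_zero, if_false]
  ring
end

section
/- Let X₁, X₂ ∈ M_k(ℂ) be Hermitian matrices and let I denote the k×k identity matrix. Then the trace tr(X₂X₁⁴X₂ + X₂²X₁²X₂² − 3·X₂X₁²X₂ + I) is a nonnegative real number. -/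
open scoped ComplexOrder

/-- A Hermitian matrix is unitarily diagonalizable, and so are its powers. -/
lemma herm_pow_diag {k : ℕ} (X : Matrix (Fin k) (Fin k) ℂ) (h : X.IsHermitian) :
    ∃ (U : Matrix (Fin k) (Fin k) ℂ) (d : Fin k → ℝ),
      ∀ n : ℕ, X ^ n = U * Matrix.diagonal (fun i => ((d i ^ n : ℝ) : ℂ)) * star U := by
  have hU : star (h.eigenvectorUnitary : Matrix (Fin k) (Fin k) ℂ) *
      (h.eigenvectorUnitary : Matrix (Fin k) (Fin k) ℂ) = 1 := by simp
  have hU' : (h.eigenvectorUnitary : Matrix (Fin k) (Fin k) ℂ) *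
      star (h.eigenvectorUnitary : Matrix (Fin k) (Fin k) ℂ) = 1 := by simp
  have hs : X = (h.eigenvectorUnitary : Matrix (Fin k) (Fin k) ℂ) *
      Matrix.diagonal (fun i => ((h.eigenvalues i : ℝ) : ℂ)) *
      star (h.eigenvectorUnitary : Matrix (Fin k) (Fin k) ℂ) := by
    have := h.spectral_theorem
    rw [Unitary.conjStarAlgAut_apply] at this
    exact this
  generalize (h.eigenvectorUnitary : Matrix (Fin k) (Fin k) ℂ) = U at *
  refine ⟨U, h.eigenvalues, fun n => ?_⟩
  generalize h.eigenvalues = d at *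
  induction n with
  | zero => simp [hU']
  | succ n ih =>
    have hd : Matrix.diagonal (fun i => ((d i ^ (n+1) : ℝ) : ℂ)) =
        Matrix.diagonal (fun i => ((d i ^ n : ℝ) : ℂ)) *
          Matrix.diagonal (fun i => ((d i : ℝ) : ℂ)) := by
      rw [Matrix.diagonal_mul_diagonal]
      congr 1
      ext i
      push_cast
      ring
    rw [pow_succ, ih, hd]
    nth_rewrite 1 [hs]
    calc _ = U * Matrix.diagonal (fun i => ((d i ^ n : ℝ) : ℂ)) * (star U * U) *
          Matrix.diagonal (fun i => ((d i : ℝ) : ℂ)) * star U := by noncomm_ring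
      _ = _ := by rw [hU]; noncomm_ring

/-- Joint spectral weights of two Hermitian matrices. -/
lemma trace_pow_mul_pow {k : ℕ} (X Y : Matrix (Fin k) (Fin k) ℂ)
    (hX : X.IsHermitian) (hY : Y.IsHermitian) :
    ∃ (a b : Fin k → ℝ) (w : Fin k → Fin k → ℝ), (∀ i j, 0 ≤ w i j) ∧
      ∀ m n : ℕ, Matrix.trace (X ^ m * Y ^ n) =
        ((∑ i, ∑ j, w i j * (a i ^ m * b j ^ n) : ℝ) : ℂ) := by
  obtain ⟨U, a, ha⟩ := herm_pow_diag X hX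
  obtain ⟨V, b, hb⟩ := herm_pow_diag Y hY
  refine ⟨a, b, fun i j => Complex.normSq ((star U * V) i j),
    fun i j => Complex.normSq_nonneg _, fun m n => ?_⟩
  rw [ha, hb]
  have h1 : Matrix.trace (U * Matrix.diagonal (fun i => ((a i ^ m : ℝ) : ℂ)) * star U *
      (V * Matrix.diagonal (fun i => ((b i ^ n : ℝ) : ℂ)) * star V)) =
      Matrix.trace (Matrix.diagonal (fun i => ((a i ^ m : ℝ) : ℂ)) *
        ((star U * V) * Matrix.diagonal (fun i => ((b i ^ n : ℝ) : ℂ)) *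
          star (star U * V))) := by
    rw [mul_assoc, mul_assoc, Matrix.trace_mul_comm]
    congr 1
    rw [star_mul, star_star]
    noncomm_ring
  rw [h1]
  generalize star U * V = W
  simp only [Matrix.trace, Matrix.diag, Matrix.diagonal_mul]
  push_cast
  refine Finset.sum_congr rfl fun i _ => ?_
  rw [Matrix.mul_apply, Finset.mul_sum]
  refine Finset.sum_congr rfl fun j _ => ?_
  rw [Matrix.mul_diagonal, Matrix.star_apply, Complex.normSq_eq_conj_mul_self]
  simp only [RCLike.star_def]
  push_cast
  ring

/-- The commutative Motzkin polynomial is nonnegative. -/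
lemma motzkin_real (x y : ℝ) :
    0 ≤ x ^ 4 * y ^ 2 + x ^ 2 * y ^ 4 - 3 * (x ^ 2 * y ^ 2) + x ^ 0 * y ^ 0 := by
  by_cases h : x ^ 2 + y ^ 2 = 0
  · have hx : x = 0 := by nlinarith [sq_nonneg x, sq_nonneg y]
    subst hx
    norm_num
  · have hp : 0 < x ^ 2 + y ^ 2 := lt_of_le_of_ne (by positivity) (Ne.symm h)
    have hh : 0 ≤ (x ^ 2 + y ^ 2) *
        (x ^ 4 * y ^ 2 + x ^ 2 * y ^ 4 - 3 * (x ^ 2 * y ^ 2) + x ^ 0 * y ^ 0) := by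
      have : (x ^ 2 + y ^ 2) *
          (x ^ 4 * y ^ 2 + x ^ 2 * y ^ 4 - 3 * (x ^ 2 * y ^ 2) + x ^ 0 * y ^ 0) =
          y ^ 2 * (1 - x ^ 2) ^ 2 + x ^ 2 * (1 - y ^ 2) ^ 2 +
          x ^ 2 * y ^ 2 * (x ^ 2 + y ^ 2 - 2) ^ 2
          + (x ^ 2 * y ^ 2) * 0 := by
        ring
      rw [this]
      positivity
    exact nonneg_of_mul_nonneg_right hh hp

/-- **Matrix trace positivity of the lifted Motzkin polynomial (cf. Example `ex:motzkin`
and Corollary `c:cyc`).** For Hermitian `X₁, X₂ ∈ M_k(ℂ)`, the trace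
`tr(X₂X₁⁴X₂ + X₂²X₁²X₂² − 3X₂X₁²X₂ + I)` is a nonnegative real number. -/
theorem nc_motzkin_trace_nonneg (k : ℕ) (X₁ X₂ : Matrix (Fin k) (Fin k) ℂ)
    (h₁ : X₁.IsHermitian) (h₂ : X₂.IsHermitian) :
    0 ≤ Matrix.trace (X₂ * X₁ ^ 4 * X₂ + X₂ ^ 2 * X₁ ^ 2 * X₂ ^ 2 -
      3 * (X₂ * X₁ ^ 2 * X₂) + 1) := by
  obtain ⟨a, b, w, hw, ht⟩ := trace_pow_mul_pow X₁ X₂ h₁ h₂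
  have e1 : Matrix.trace (X₂ * X₁ ^ 4 * X₂) = Matrix.trace (X₁ ^ 4 * X₂ ^ 2) := by
    rw [mul_assoc, Matrix.trace_mul_comm, mul_assoc, ← pow_two]
  have e2 : Matrix.trace (X₂ ^ 2 * X₁ ^ 2 * X₂ ^ 2) = Matrix.trace (X₁ ^ 2 * X₂ ^ 4) := by
    rw [mul_assoc, Matrix.trace_mul_comm, mul_assoc, ← pow_add]
  have e3 : Matrix.trace (3 * (X₂ * X₁ ^ 2 * X₂)) = 3 * Matrix.trace (X₁ ^ 2 * X₂ ^ 2) := by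
    have : (3 : Matrix (Fin k) (Fin k) ℂ) * (X₂ * X₁ ^ 2 * X₂) =
        (3 : ℂ) • (X₂ * X₁ ^ 2 * X₂) := by
      rw [← smul_one_mul]
      congr 1
      rw [← Algebra.algebraMap_eq_smul_one, map_ofNat]
    rw [this, Matrix.trace_smul, smul_eq_mul, mul_assoc, Matrix.trace_mul_comm, mul_assoc,
      ← pow_two]
  have e4 : Matrix.trace (1 : Matrix (Fin k) (Fin k) ℂ) = Matrix.trace (X₁ ^ 0 * X₂ ^ 0) := by
    simp
  rw [Matrix.trace_add, Matrix.trace_sub, Matrix.trace_add, e1, e2, e3, e4, ht, ht, ht, ht]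
  have key : 0 ≤ ∑ i, ∑ j, w i j * (a i ^ 4 * b j ^ 2 + a i ^ 2 * b j ^ 4 -
      3 * (a i ^ 2 * b j ^ 2) + a i ^ 0 * b j ^ 0) :=
    Finset.sum_nonneg fun i _ => Finset.sum_nonneg fun j _ =>
      mul_nonneg (hw i j) (motzkin_real _ _)
  have hsum : ∑ i, ∑ j, w i j * (a i ^ 4 * b j ^ 2 + a i ^ 2 * b j ^ 4 -
      3 * (a i ^ 2 * b j ^ 2) + a i ^ 0 * b j ^ 0) =
      (∑ i, ∑ j, w i j * (a i ^ 4 * b j ^ 2)) + (∑ i, ∑ j, w i j * (a i ^ 2 * b j ^ 4)) -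
      3 * (∑ i, ∑ j, w i j * (a i ^ 2 * b j ^ 2)) +
      (∑ i, ∑ j, w i j * (a i ^ 0 * b j ^ 0)) := by
    simp only [Finset.mul_sum, ← Finset.sum_add_distrib, ← Finset.sum_sub_distrib]
    refine Finset.sum_congr rfl fun i _ => Finset.sum_congr rfl fun j _ => ?_
    ring
  rw [hsum] at key
  exact_mod_cast key
end

section
/- Let n ≥ 1 and suppose s ∈ ℝ⟨x₁,…,xₙ⟩ is simultaneously a sum of hermitian squares and an element of Θ, the linear span of commutators. Then s = 0. -/
open Matrix

/-- The symmetric path matrices attached to a word. -/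
noncomputable def pathMat {n : ℕ} (w : List (Fin n)) (i : Fin n) :
    Matrix (Fin (w.length + 1)) (Fin (w.length + 1)) ℝ :=
  Matrix.of fun a b =>
    if (a.val + 1 = b.val ∧ w[a.val]? = some i) ∨ (b.val + 1 = a.val ∧ w[b.val]? = some i)
    then 1 else 0

theorem pathMat_transpose {n : ℕ} (w : List (Fin n)) (i : Fin n) :
    (pathMat w i)ᵀ = pathMat w i := by
  ext a b
  simp only [pathMat, Matrix.transpose_apply, Matrix.of_apply]
  congr 1
  exact propext or_comm

theorem path_entry_lt {n : ℕ} (w : List (Fin n)) (v : List (Fin n)) :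
    ∀ a : Fin (w.length + 1), a.val + v.length < w.length →
      (v.map (pathMat w)).prod a (Fin.last _) = 0 := by
  induction v with
  | nil =>
    intro a h
    have : a ≠ Fin.last _ := by
      intro h'; subst h'; simp at h
    simp [this]
  | cons i v ih =>
    intro a h
    simp only [List.length_cons] at h
    rw [List.map_cons, List.prod_cons, Matrix.mul_apply]
    apply Finset.sum_eq_zero
    intro c _
    by_cases hc : c.val ≤ a.val + 1
    · rw [ih c (by omega), mul_zero]
    · have : pathMat w i a c = 0 := by
        simp only [pathMat, Matrix.of_apply]
        rw [if_neg]; omega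
      rw [this, zero_mul]

theorem path_entry_eq {n : ℕ} (w : List (Fin n)) (v : List (Fin n)) :
    ∀ a : Fin (w.length + 1), a.val + v.length = w.length →
      (v.map (pathMat w)).prod a (Fin.last _) = if v = w.drop a.val then 1 else 0 := by
  induction v with
  | nil =>
    intro a h
    have : a = Fin.last _ := by
      ext; simpa using h
    subst this
    simp
  | cons i v ih =>
    intro a h
    simp only [List.length_cons] at h
    have ha : a.val < w.length := by omega
    rw [List.map_cons, List.prod_cons, Matrix.mul_apply]
    rw [Finset.sum_eq_single (⟨a.val + 1, by omega⟩ : Fin (w.length + 1))]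
    · rw [ih _ (by simp only; omega), List.drop_eq_getElem_cons ha]
      have : pathMat w i a ⟨a.val + 1, by omega⟩ = if i = w[a.val] then 1 else 0 := by
        simp only [pathMat, Matrix.of_apply]
        congr 1
        simp [ha, eq_comm]
        omega
      rw [this]
      simp only [List.cons.injEq]
      split_ifs <;> simp_all
    · intro c _ hc
      have hc' : c.val ≠ a.val + 1 := fun h => hc (Fin.ext h)
      by_cases hc : c.val ≤ a.val
      · rw [path_entry_lt w v c (by omega), mul_zero]
      · have : pathMat w i a c = 0 := by
          simp only [pathMat, Matrix.of_apply]
          rw [if_neg]; omega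
        rw [this, zero_mul]
    · simp

/-- The representation given by the path matrices. -/
noncomputable def pathRep {n : ℕ} (w : List (Fin n)) :
    FreeAlgebra ℝ (Fin n) →ₐ[ℝ] Matrix (Fin (w.length + 1)) (Fin (w.length + 1)) ℝ :=
  FreeAlgebra.lift ℝ (pathMat w)

theorem pathRep_star {n : ℕ} (w : List (Fin n)) (p : FreeAlgebra ℝ (Fin n)) :
    pathRep w (star p) = (pathRep w p)ᵀ := by
  induction p using FreeAlgebra.induction with
  | grade0 r =>
    rw [FreeAlgebra.star_algebraMap, AlgHom.commutes, Matrix.algebraMap_eq_diagonal,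
      Matrix.diagonal_transpose]
  | grade1 x => simp [pathRep, pathMat_transpose]
  | mul a b ha hb => rw [star_mul, map_mul, map_mul, Matrix.transpose_mul, ha, hb]
  | add a b ha hb => rw [star_add, map_add, map_add, Matrix.transpose_add, ha, hb]

theorem pathRep_theta {n : ℕ} (w : List (Fin n)) (s : FreeAlgebra ℝ (Fin n))
    (h : s ∈ thetaCommutators n) : (pathRep w s).trace = 0 := by
  unfold thetaCommutators at h
  induction h using Submodule.span_induction with
  | mem x hx =>
    obtain ⟨p, q, rfl⟩ := hx
    rw [map_sub, map_mul, map_mul, Matrix.trace_sub, Matrix.trace_mul_comm, sub_self]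
  | zero => simp
  | add x y _ _ hx hy => rw [map_add, Matrix.trace_add, hx, hy, add_zero]
  | smul a x _ hx => rw [map_smul, Matrix.trace_smul, hx, smul_zero]

theorem pathRep_eq {n : ℕ} (w : List (Fin n)) (p : FreeAlgebra ℝ (Fin n)) :
    pathRep w p = MonoidAlgebra.lift ℝ _ _ (FreeMonoid.lift (pathMat w))
      (FreeAlgebra.equivMonoidAlgebraFreeMonoid p) := by
  have : pathRep w = (MonoidAlgebra.lift ℝ _ _ (FreeMonoid.lift (pathMat w))).comp
      (FreeAlgebra.equivMonoidAlgebraFreeMonoid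
        (R := ℝ) (X := Fin n)).toAlgHom := by
    apply FreeAlgebra.hom_ext
    funext x
    simp [pathRep, FreeAlgebra.equivMonoidAlgebraFreeMonoid]
  rw [this]; rfl

theorem exists_pathRep_ne_zero {n : ℕ} (p : FreeAlgebra ℝ (Fin n)) (hp : p ≠ 0) :
    ∃ w : List (Fin n), pathRep w p ≠ 0 := by
  set f := FreeAlgebra.equivMonoidAlgebraFreeMonoid p with hf
  have hf0 : f ≠ 0 := by
    rw [hf]; simpa using hp
  have hs : f.coeff.support.Nonempty := by
    rw [Finsupp.support_nonempty_iff]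
    simpa using hf0
  obtain ⟨w, hw, hmax⟩ := Finset.exists_max_image f.coeff.support
    (fun v => (FreeMonoid.toList v).length) hs
  refine ⟨FreeMonoid.toList w, fun h => ?_⟩
  have h1 := congrFun (congrFun h 0) (Fin.last _)
  rw [pathRep_eq, ← hf, MonoidAlgebra.lift_apply, Finsupp.sum, Matrix.sum_apply,
    Finset.sum_eq_single w] at h1
  · rw [Matrix.smul_apply, FreeMonoid.lift_apply, path_entry_eq _ _ _ (by simp)] at h1
    simp at h1
    exact (Finsupp.mem_support_iff.mp hw) h1
  · intro v hv hne
    rw [Matrix.smul_apply, FreeMonoid.lift_apply]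
    rcases (hmax v hv).lt_or_eq with hlt | heq
    · rw [path_entry_lt _ _ _ (by simpa using hlt), smul_zero]
    · rw [path_entry_eq _ _ _ (by simpa using heq), if_neg, smul_zero]
      simpa using hne
  · exact fun h => absurd hw h

theorem trace_sq_nonneg {m : ℕ} (A : Matrix (Fin m) (Fin m) ℝ) : 0 ≤ (A * Aᵀ).trace := by
  simp only [Matrix.trace, Matrix.diag, Matrix.mul_apply, Matrix.transpose_apply]
  exact Finset.sum_nonneg fun i _ => Finset.sum_nonneg fun j _ => mul_self_nonneg _

/-- **Lemma `l:cones`(c), polynomial case.** If `s ∈ ℝ⟨x₁,…,xₙ⟩` is simultaneously a sum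
of hermitian squares and an element of `Θ` (the span of commutators), then `s = 0`. -/
theorem sohs_inter_commutators_eq_zero (n : ℕ) (hn : 1 ≤ n) (s : FreeAlgebra ℝ (Fin n))
    (h1 : ∃ l : List (FreeAlgebra ℝ (Fin n)), s = (l.map fun p => p * star p).sum)
    (h2 : s ∈ thetaCommutators n) : s = 0 := by
  obtain ⟨l, rfl⟩ := h1
  have key : ∀ p ∈ l, p = 0 := by
    intro p hp
    by_contra hne
    obtain ⟨w, hw⟩ := exists_pathRep_ne_zero p hne
    apply hw
    have h := pathRep_theta w _ h2
    have h' : (l.map fun p => (pathRep w p * (pathRep w p)ᵀ).trace).sum = 0 := by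
      rw [← h]
      clear h h2 hp hne
      induction l with
      | nil => simp
      | cons a l ih => simp [ih, pathRep_star]
    have hle : (pathRep w p * (pathRep w p)ᵀ).trace ≤
        (l.map fun p => (pathRep w p * (pathRep w p)ᵀ).trace).sum := by
      apply List.single_le_sum
      · intro x hx
        obtain ⟨q, _, rfl⟩ := List.mem_map.mp hx
        exact trace_sq_nonneg _
      · exact List.mem_map.mpr ⟨p, hp, rfl⟩
    have h0 := le_antisymm (hle.trans h'.le) (trace_sq_nonneg _)
    rw [← Matrix.conjTranspose_eq_transpose_of_trivial] at h0
    exact Matrix.trace_mul_conjTranspose_self_eq_zero_iff.mp h0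
  apply List.sum_eq_zero
  intro x hx
  obtain ⟨q, hq, rfl⟩ := List.mem_map.mp hx
  simp [key q hq]
end
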